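/- Let (D, ω) be a good weighted oriented graph and let L be a good weighted median order of (D, ω). Then the sedimentation Sed(L) is again a good weighted median order of (D, ω). -/

import Mathlib

variable {V : Type*}

/-- Out-neighborhood of `v`. -/
def Nplus (E : V → V → Prop) (v : V) : Set V := {w | E v w}

/-- In-neighborhood of `v`. -/
def Nminus (E : V → V → Prop) (v : V) : Set V := {w | E w v}

/-- Second out-neighborhood: vertices at directed distance exactly 2 from `v`. -/
def Npp (E : V → V → Prop) (v : V) : Set V :=
  {w | w ≠ v ∧ ¬ E v w ∧ ∃ u, E v u ∧ E u w}

/-- Weight of a set of vertices. -/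
noncomputable def wt (ω : V → ℝ) (S : Set V) : ℝ := ∑ᶠ x ∈ S, ω x

/-- Total weight of the forward arcs of the ordering `L`. -/
noncomputable def fwdW {n : ℕ} (E : V → V → Prop) (ω : V → ℝ) (L : Fin n ≃ V) : ℝ :=
  ∑ᶠ p ∈ {p : Fin n × Fin n | p.1 < p.2 ∧ E (L p.1) (L p.2)}, ω (L p.1) * ω (L p.2)

/-- `L` is a weighted median order of `(E, ω)`. -/
def IsWMedian {n : ℕ} (E : V → V → Prop) (ω : V → ℝ) (L : Fin n ≃ V) : Prop :=
  ∀ L' : Fin n ≃ V, fwdW E ω L' ≤ fwdW E ω L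

/-- Number of forward arcs of the ordering `L`. -/
noncomputable def fwdCount {n : ℕ} (E : V → V → Prop) (L : Fin n ≃ V) : ℕ :=
  Set.ncard {p : Fin n × Fin n | p.1 < p.2 ∧ E (L p.1) (L p.2)}

/-- `L` is a (unweighted) median order of `E`. -/
def IsMedian {n : ℕ} (E : V → V → Prop) (L : Fin n ≃ V) : Prop :=
  ∀ L' : Fin n ≃ V, fwdCount E L' ≤ fwdCount E L

/-- `K` is an interval of the digraph `E`. -/
def IsInterval (E : V → V → Prop) (K : Set V) : Prop :=
  ∀ u ∈ K, ∀ v ∈ K,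
    Nplus E u \ K = Nplus E v \ K ∧ Nminus E u \ K = Nminus E v \ K

/-- `K` occurs as a set of consecutive vertices of the ordering `L`. -/
def OrderConvex {n : ℕ} (L : Fin n ≃ V) (K : Set V) : Prop :=
  ∀ i j k : Fin n, i ≤ j → j ≤ k → L i ∈ K → L k ∈ K → L j ∈ K

/-- `{x, y}` is a missing edge. -/
def IsMissing (E : V → V → Prop) (x y : V) : Prop := x ≠ y ∧ ¬ E x y ∧ ¬ E y x

/-- The unordered pair `e` is a missing edge. -/
def IsMissingS (E : V → V → Prop) (e : Sym2 V) : Prop :=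
  ∃ x y, e = s(x, y) ∧ IsMissing E x y

/-- The labelled losing relation: the missing edge `x₁y₁` loses to the missing edge `x₂y₂`
with this labelling of the endpoints. -/
def LosesLab (E : V → V → Prop) (x1 y1 x2 y2 : V) : Prop :=
  IsMissing E x1 y1 ∧ IsMissing E x2 y2 ∧
  E x1 x2 ∧ y2 ∉ Nplus E x1 ∪ Npp E x1 ∧ E y1 y2 ∧ x2 ∉ Nplus E y1 ∪ Npp E y1

/-- The losing relation on missing edges: the arcs of the dependency digraph `Δ`. -/
def Loses (E : V → V → Prop) (e f : Sym2 V) : Prop :=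
  ∃ x1 y1 x2 y2, e = s(x1, y1) ∧ f = s(x2, y2) ∧ LosesLab E x1 y1 x2 y2

/-- One merging step used to generate the sets `K(ξ)`. -/
def MissTouch (E : V → V → Prop) (u v : V) : Prop :=
  IsMissing E u v ∨ ∃ e f : Sym2 V, Loses E e f ∧ u ∈ e ∧ v ∈ f

/-- `u` and `v` lie in the same set `K(ξ)` (or `u = v`). -/
def SameK (E : V → V → Prop) : V → V → Prop := Relation.EqvGen (MissTouch E)

/-- `J(f)`: equal to `{f}` when `f` is whole, and to `K(ξ)` for the unique connected
component `ξ` of the interval graph with `f ∈ K(ξ)` otherwise. -/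
def Jset (E : V → V → Prop) (f : V) : Set V := {v | SameK E f v}

/-- A good digraph: all sets `K(ξ)` are intervals. -/
def GoodDigraph (E : V → V → Prop) : Prop := ∀ f : V, IsInterval E (Jset E f)

/-- The set `G_L` of good vertices of the ordering `L`. -/
def GoodSet {n : ℕ} (E : V → V → Prop) (L : Fin (n + 1) ≃ V) : Set V :=
  {w | w ∉ Nplus E (L (Fin.last n)) ∧
    ∃ i j : Fin (n + 1), i ≤ j ∧ w = L j ∧ E (L (Fin.last n)) (L i) ∧ E (L i) w}

/-- The subdigraph of `E` induced on `K`. -/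
def ERestrict (E : V → V → Prop) (K : Set V) : V → V → Prop :=
  fun x y => x ∈ K ∧ y ∈ K ∧ E x y

/-- `(a, b)` is a convenient orientation of the missing edge `ab`. -/
def ConvenientFor (E : V → V → Prop) (a b : V) : Prop :=
  ∀ v, v ≠ a → v ≠ b → E v a → b ∈ Nplus E v ∪ Npp E v

/-- Two missing edges lie in the same connected component of the dependency digraph. -/
def DeltaConn (E : V → V → Prop) : Sym2 V → Sym2 V → Prop :=
  Relation.ReflTransGen (fun e f => Loses E e f ∨ Loses E f e)

/-- The connected component of `e` in the dependency digraph is a (maximal directed) path,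
i.e. it contains a missing edge of in-degree zero. -/
def InPathComp (E : V → V → Prop) (e : Sym2 V) : Prop :=
  ∃ f, IsMissingS E f ∧ DeltaConn E e f ∧ ¬ ∃ g, Loses E g f

open Classical in
/-- Arc weight. -/
noncomputable def arcW (E : V → V → Prop) (ω : V → ℝ) (x y : V) : ℝ :=
  if E x y then ω x * ω y else 0

open Classical in
theorem fwdW_eq [Fintype V] {n : ℕ} (E : V → V → Prop) (ω : V → ℝ) (L : Fin n ≃ V) :
    fwdW E ω L = ∑ x, ∑ y, if L.symm x < L.symm y then arcW E ω x y else 0 := by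
  unfold fwdW
  simp only [finsum_mem_def]
  rw [finsum_eq_sum_of_fintype, Fintype.sum_prod_type]
  rw [← Equiv.sum_comp L.symm]
  refine Finset.sum_congr rfl fun x _ => ?_
  rw [← Equiv.sum_comp L.symm]
  refine Finset.sum_congr rfl fun y _ => ?_
  simp only [Set.indicator, Set.mem_setOf_eq, Equiv.apply_symm_apply, arcW]
  split_ifs <;> simp_all

open Classical in
theorem wt_eq [Fintype V] (ω : V → ℝ) (S : Set V) :
    wt ω S = ∑ x, if x ∈ S then ω x else 0 := by
  unfold wt
  simp only [finsum_mem_def]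
  rw [finsum_eq_sum_of_fintype]
  rfl

theorem exists_order [Fintype V] {n : ℕ} (L : Fin n ≃ V) (key : V → ℕ)
    (hk : Function.Injective key) :
    ∃ M : Fin n ≃ V, ∀ x y, M.symm x < M.symm y ↔ key x < key y := by
  letI : LinearOrder V := LinearOrder.lift' key hk
  have hc : Fintype.card V = n := by
    rw [← Fintype.card_congr L]; simp
  let e := Fintype.orderIsoFinOfCardEq V hc
  refine ⟨e.toEquiv, fun x y => ?_⟩
  exact e.symm.lt_iff_lt

open Classical in
theorem block_swap [Fintype V] {n : ℕ} (E : V → V → Prop) (ω : V → ℝ) (L : Fin n ≃ V)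
    (hL : IsWMedian E ω L) (j k l : ℕ) (hjk : j ≤ k) (hkl : k ≤ l) (C A : V → Prop)
    (hC : ∀ x, C x ↔ k ≤ (L.symm x : ℕ) ∧ (L.symm x : ℕ) < l)
    (hA : ∀ x, A x ↔ j ≤ (L.symm x : ℕ) ∧ (L.symm x : ℕ) < k) :
    (∑ x, ∑ y, if C x ∧ A y then arcW E ω x y else 0) ≤
      ∑ x, ∑ y, if C x ∧ A y then arcW E ω y x else 0 := by
  let key : V → ℕ := fun x =>
    if A x then (L.symm x : ℕ) + (l - k) else if C x then (L.symm x : ℕ) - (k - j)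
      else (L.symm x : ℕ)
  have hk : Function.Injective key := by
    intro x y hxy
    apply L.symm.injective
    apply Fin.ext
    simp only [key, hA, hC] at hxy
    split_ifs at hxy <;> omega
  obtain ⟨M, hM⟩ := exists_order L key hk
  have h := hL M
  rw [fwdW_eq, fwdW_eq] at h
  have h2 : (∑ x, ∑ y, if C x ∧ A y then arcW E ω y x else 0) =
      ∑ x, ∑ y, if C y ∧ A x then arcW E ω x y else 0 := Finset.sum_comm
  rw [h2]
  have h3 : (∑ x, ∑ y, if M.symm x < M.symm y then arcW E ω x y else 0) =
      ∑ x, ∑ y, ((if L.symm x < L.symm y then arcW E ω x y else 0) +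
        (if C x ∧ A y then arcW E ω x y else 0) - (if C y ∧ A x then arcW E ω x y else 0)) := by
    refine Finset.sum_congr rfl fun x _ => Finset.sum_congr rfl fun y _ => ?_
    have hlt : (L.symm x < L.symm y) = ((L.symm x : ℕ) < (L.symm y : ℕ)) := by
      rw [Fin.lt_def]
    simp only [hM, hlt]
    have hh : (key x < key y ∧ (C x ∧ A y) ∧ ¬ (C y ∧ A x) ∧ ¬ (L.symm x : ℕ) < L.symm y) ∨
        (¬ key x < key y ∧ ¬ (C x ∧ A y) ∧ (C y ∧ A x) ∧ (L.symm x : ℕ) < L.symm y) ∨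
        ((key x < key y ↔ (L.symm x : ℕ) < L.symm y) ∧ ¬ (C x ∧ A y) ∧ ¬ (C y ∧ A x)) := by
      simp only [key, hA, hC]
      split_ifs <;> omega
    rcases hh with ⟨a, b, c, d⟩ | ⟨a, b, c, d⟩ | ⟨a, b, c⟩
    · simp only [a, b, c, d, if_true, if_false, and_self]; ring
    · simp only [a, b, c, d, if_true, if_false, and_self]; ring
    · simp only [a, b, c, if_false]; ring
  rw [h3] at h
  simp only [Finset.sum_add_distrib, Finset.sum_sub_distrib] at h
  linarith

open Classical in
/-- Havet and Thomassé style inequality on final segments. -/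
theorem seg_ineq [Fintype V] (E : V → V → Prop) (ω : V → ℝ) (hω : ∀ v, 0 < ω v)
    (p : V → ℕ) (hp : Function.Injective p) (f : V) (m N : ℕ) (hN : ∀ x, p x < N)
    (hmN : m ≤ N) (hfm : m ≤ p f)
    (hswap : ∀ j k l : ℕ, j ≤ k → k ≤ l → ∀ C A : V → Prop,
      (∀ x, C x ↔ k ≤ p x ∧ p x < l) → (∀ x, A x ↔ j ≤ p x ∧ p x < k) →
      (∑ x, ∑ y, if C x ∧ A y then arcW E ω x y else 0) ≤
        ∑ x, ∑ y, if C x ∧ A y then arcW E ω y x else 0)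
    (hmiss : ∀ b r, p b < m → p r < m → ¬ E f b → E f r → ¬ E r b → E b r)
    (hJ1 : ∀ c x, m ≤ p c → p x < m → (E c x ↔ E f x))
    (hJ2 : ∀ c x, m ≤ p c → p x < m → (E x c ↔ ¬ E f x)) :
    ∀ d j : ℕ, m ≤ j + d →
      (∑ x, if j ≤ p x ∧ p x < m ∧ E f x then ω x else 0) ≤
      ∑ x, if j ≤ p x ∧ p x < m ∧ ¬ E f x ∧ ∃ u, j ≤ p u ∧ p u ≤ p x ∧ E f u ∧ E u x
        then ω x else 0 := by
  intro d
  induction d using Nat.strong_induction_on with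
  | _ d ih =>
  intro j hd
  by_cases hjm : m ≤ j
  · apply Finset.sum_le_sum
    intro x _
    rw [if_neg (by omega), if_neg (by omega)]
  push Not at hjm
  by_cases hbad : ∃ k b, p b = k ∧ j ≤ p b ∧ p b < m ∧ ¬ E f b ∧
      ¬ ∃ u, j ≤ p u ∧ p u ≤ p b ∧ E f u ∧ E u b
  · obtain ⟨b, hbk, hjb, hbm, hfb, hub⟩ := Nat.find_spec hbad
    have hmin : ∀ x, j ≤ p x → p x < p b → ¬ E f x →
        ∃ u, j ≤ p u ∧ p u ≤ p x ∧ E f u ∧ E u x := by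
      intro x h1 h2 h3
      by_contra h4
      rw [hbk] at h2
      exact Nat.find_min hbad h2 ⟨x, rfl, h1, by omega, h3, h4⟩
    have hIH := ih (m - (p b + 1)) (by omega) (p b + 1) (by omega)
    have hs0 := hswap j (p b) (p b + 1) hjb (by omega) (fun x => x = b)
      (fun x => j ≤ p x ∧ p x < p b)
      (fun x => ⟨fun h => by subst h; omega, fun h => hp (by omega)⟩) (fun x => Iff.rfl)
    have e1 : ∀ g : V → V → ℝ, (∑ x, ∑ y, if x = b ∧ (j ≤ p y ∧ p y < p b) then g x y else 0) =
        ∑ y, if j ≤ p y ∧ p y < p b then g b y else 0 := by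
      intro g
      rw [Finset.sum_eq_single b]
      · simp
      · intro x _ hx
        simp [hx]
      · simp
    have hs : (∑ x, ∑ y, if x = b ∧ (j ≤ p y ∧ p y < p b) then arcW E ω x y else 0) ≤
        ∑ x, ∑ y, if x = b ∧ (j ≤ p y ∧ p y < p b) then arcW E ω y x else 0 := by
      convert hs0
    rw [e1, e1 (fun x y => arcW E ω y x)] at hs
    have h1 : ω b * (∑ x, if j ≤ p x ∧ p x < p b ∧ E f x then ω x else 0) ≤
        ∑ y, if j ≤ p y ∧ p y < p b then arcW E ω b y else 0 := by
      rw [Finset.mul_sum]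
      apply Finset.sum_le_sum
      intro x _
      by_cases hx : j ≤ p x ∧ p x < p b
      · rw [if_pos hx]
        by_cases hfx : E f x
        · have : E b x := hmiss b x hbm (by omega) hfb hfx
            (fun h => hub ⟨x, hx.1, by omega, hfx, h⟩)
          rw [if_pos ⟨hx.1, hx.2, hfx⟩, arcW, if_pos this]
        · rw [if_neg (by tauto), arcW]
          have := mul_pos (hω b) (hω x)
          split_ifs <;> simp <;> linarith
      · rw [if_neg hx, if_neg (by tauto)]; simp
    have h2 : (∑ y, if j ≤ p y ∧ p y < p b then arcW E ω y b else 0) ≤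
        ω b * (∑ x, if j ≤ p x ∧ p x < p b ∧ ¬ E f x then ω x else 0) := by
      rw [Finset.mul_sum]
      apply Finset.sum_le_sum
      intro x _
      by_cases hx : j ≤ p x ∧ p x < p b
      · rw [if_pos hx]
        have := mul_pos (hω b) (hω x)
        by_cases hfx : E f x
        · have hn : ¬ E x b := (fun h => hub ⟨x, hx.1, by omega, hfx, h⟩)
          rw [if_neg (by tauto), arcW, if_neg hn]; simp
        · rw [if_pos ⟨hx.1, hx.2, hfx⟩, arcW]
          split_ifs <;> linarith
      · rw [if_neg hx, if_neg (by tauto)]; simp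
    have h3 := le_of_mul_le_mul_left (h1.trans (hs.trans h2)) (hω b)
    calc (∑ x, if j ≤ p x ∧ p x < m ∧ E f x then ω x else 0)
        ≤ (∑ x, if j ≤ p x ∧ p x < p b ∧ E f x then ω x else 0) +
          ∑ x, if p b + 1 ≤ p x ∧ p x < m ∧ E f x then ω x else 0 := by
          rw [← Finset.sum_add_distrib]
          apply Finset.sum_le_sum
          intro x _
          have := hω x
          by_cases hxb : x = b
          · subst hxb
            simp [hfb]
          · have : p x ≠ p b := fun h => hxb (hp h)
            by_cases hfx : E f x
            · simp only [hfx, and_true]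
              split_ifs <;> first | omega | linarith
            · simp [hfx]
      _ ≤ (∑ x, if j ≤ p x ∧ p x < p b ∧ ¬ E f x then ω x else 0) +
          ∑ x, if p b + 1 ≤ p x ∧ p x < m ∧ ¬ E f x ∧
            ∃ u, p b + 1 ≤ p u ∧ p u ≤ p x ∧ E f u ∧ E u x then ω x else 0 := add_le_add h3 hIH
      _ ≤ _ := by
          rw [← Finset.sum_add_distrib]
          apply Finset.sum_le_sum
          intro x _
          have := hω x
          by_cases c1 : j ≤ p x ∧ p x < p b ∧ ¬ E f x
          · rw [if_pos c1, if_neg (by omega),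
              if_pos ⟨c1.1, by omega, c1.2.2, hmin x c1.1 c1.2.1 c1.2.2⟩]
            simp
          · rw [if_neg c1]
            by_cases c2 : p b + 1 ≤ p x ∧ p x < m ∧ ¬ E f x ∧
                ∃ u, p b + 1 ≤ p u ∧ p u ≤ p x ∧ E f u ∧ E u x
            · obtain ⟨a1, a2, a3, u, a4, a5, a6, a7⟩ := id c2
              rw [if_pos c2, if_pos ⟨by omega, a2, a3, u, by omega, a5, a6, a7⟩]
              simp
            · rw [if_neg c2]
              split_ifs <;> simp <;> linarith
  · have hall : ∀ x, j ≤ p x → p x < m → ¬ E f x →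
        ∃ u, j ≤ p u ∧ p u ≤ p x ∧ E f u ∧ E u x := by
      intro x h1 h2 h3
      by_contra h4
      exact hbad ⟨_, x, rfl, h1, h2, h3, h4⟩
    have hs0 := hswap j m N hjm.le hmN (fun x => m ≤ p x) (fun x => j ≤ p x ∧ p x < m)
      (fun x => by simp [hN]) (fun x => Iff.rfl)
    have e1 : (∑ x, ∑ y, if m ≤ p x ∧ (j ≤ p y ∧ p y < m) then arcW E ω x y else 0) =
        (∑ x, if m ≤ p x then ω x else 0) *
          ∑ x, if j ≤ p x ∧ p x < m ∧ E f x then ω x else 0 := by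
      rw [Finset.sum_mul_sum]
      refine Finset.sum_congr rfl fun x _ => Finset.sum_congr rfl fun y _ => ?_
      by_cases hx : m ≤ p x
      · by_cases hy : j ≤ p y ∧ p y < m
        · simp [hx, hy, arcW, hJ1 x y hx hy.2]
        · rw [if_neg (by tauto), if_neg (by tauto : ¬ (j ≤ p y ∧ p y < m ∧ E f y))]; simp
      · simp [hx]
    have e2 : (∑ x, ∑ y, if m ≤ p x ∧ (j ≤ p y ∧ p y < m) then arcW E ω y x else 0) =
        (∑ x, if m ≤ p x then ω x else 0) *
          ∑ x, if j ≤ p x ∧ p x < m ∧ ¬ E f x then ω x else 0 := by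
      rw [Finset.sum_mul_sum]
      refine Finset.sum_congr rfl fun x _ => Finset.sum_congr rfl fun y _ => ?_
      by_cases hx : m ≤ p x
      · by_cases hy : j ≤ p y ∧ p y < m
        · simp [hx, hy, arcW, hJ2 x y hx hy.2, mul_comm]
        · rw [if_neg (by tauto), if_neg (by tauto : ¬ (j ≤ p y ∧ p y < m ∧ ¬ E f y))]; simp
      · simp [hx]
    have hs : (∑ x, ∑ y, if m ≤ p x ∧ (j ≤ p y ∧ p y < m) then arcW E ω x y else 0) ≤
        ∑ x, ∑ y, if m ≤ p x ∧ (j ≤ p y ∧ p y < m) then arcW E ω y x else 0 := by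
      convert hs0
    rw [e1, e2] at hs
    have hpos : 0 < ∑ x, if m ≤ p x then ω x else 0 := by
      apply Finset.sum_pos'
      · intro x _
        have := hω x
        split_ifs <;> linarith
      · exact ⟨f, Finset.mem_univ _, by rw [if_pos hfm]; exact hω f⟩
    refine (le_of_mul_le_mul_left hs hpos).trans (le_of_eq ?_)
    refine Finset.sum_congr rfl fun x _ => ?_
    by_cases c : j ≤ p x ∧ p x < m ∧ ¬ E f x
    · rw [if_pos c, if_pos ⟨c.1, c.2.1, c.2.2, hall x c.1 c.2.1 c.2.2⟩]
    · rw [if_neg c, if_neg (by tauto)]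

set_option maxHeartbeats 1000000 in
theorem stmt_6 {V : Type*} [Fintype V] {n : ℕ}
    (E : V → V → Prop) (hloop : ∀ v, ¬ E v v) (hdigon : ∀ x y, ¬ (E x y ∧ E y x))
    (ω : V → ℝ) (hω : ∀ v, 0 < ω v)
    (hgood : GoodDigraph E)
    (L : Fin (n + 1) ≃ V) (hL : IsWMedian E ω L)
    (hLgood : ∀ v, OrderConvex L (Jset E v))
    (f : V) (hf : f = L (Fin.last n))
    (B R : Set V)
    (hB : B = {w | w ∉ Nplus E f ∧ w ∉ GoodSet E L} \ Jset E f)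
    (hR : R = Set.univ \ (B ∪ Jset E f))
    (L' : Fin (n + 1) ≃ V)
    (hsed :
      (wt ω (Nplus E f \ Jset E f) < wt ω (GoodSet E L \ Jset E f) ∧ L' = L) ∨
      (wt ω (Nplus E f \ Jset E f) = wt ω (GoodSet E L \ Jset E f) ∧
        (∀ u v, u ∈ B → v ∈ Jset E f → L'.symm u < L'.symm v) ∧
        (∀ u v, u ∈ B → v ∈ R → L'.symm u < L'.symm v) ∧
        (∀ u v, u ∈ Jset E f → v ∈ R → L'.symm u < L'.symm v) ∧
        (∀ u v, (u ∈ B ∧ v ∈ B) ∨ (u ∈ Jset E f ∧ v ∈ Jset E f) ∨ (u ∈ R ∧ v ∈ R) →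
          (L'.symm u < L'.symm v ↔ L.symm u < L.symm v)))) :
    IsWMedian E ω L' ∧ ∀ v, OrderConvex L' (Jset E v) := by
  classical
  rcases hsed with ⟨_, rfl⟩ | ⟨heq, hBJ, hBR, hJR, hin⟩
  · exact ⟨hL, hLgood⟩
  -- basic facts on the classes
  have hself : ∀ v, v ∈ Jset E v := fun v => Relation.EqvGen.refl v
  have hsymm : ∀ {u v}, v ∈ Jset E u → u ∈ Jset E v := fun h => Relation.EqvGen.symm _ _ h
  have htrans : ∀ {u v w}, v ∈ Jset E u → w ∈ Jset E v → w ∈ Jset E u :=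
    fun h h' => Relation.EqvGen.trans _ _ _ h h'
  have hmis : ∀ {u v}, u ≠ v → ¬ E u v → ¬ E v u → v ∈ Jset E u :=
    fun h1 h2 h3 => Relation.EqvGen.rel _ _ (Or.inl ⟨h1, h2, h3⟩)
  have hout : ∀ {k u v x}, u ∈ Jset E k → v ∈ Jset E k → x ∉ Jset E k → E u x → E v x := by
    intro k u v x hu hv hx h
    have : x ∈ Nplus E u \ Jset E k := ⟨h, hx⟩
    rw [(hgood k u hu v hv).1] at this
    exact this.1
  have hinn : ∀ {k u v x}, u ∈ Jset E k → v ∈ Jset E k → x ∉ Jset E k → E x u → E x v := by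
    intro k u v x hu hv hx h
    have : x ∈ Nminus E u \ Jset E k := ⟨h, hx⟩
    rw [(hgood k u hu v hv).2] at this
    exact this.1
  -- positions
  obtain ⟨p, hpdef⟩ : ∃ p : V → ℕ, ∀ x, p x = (L.symm x : ℕ) := ⟨_, fun _ => rfl⟩
  have hp : Function.Injective p := by
    intro x y h
    rw [hpdef, hpdef] at h
    exact L.symm.injective (Fin.ext h)
  have hltp : ∀ x y, L.symm x < L.symm y ↔ p x < p y := by
    intro x y; rw [hpdef, hpdef, Fin.lt_def]
  have hconv : ∀ v x y z, p x ≤ p y → p y ≤ p z → x ∈ Jset E v → z ∈ Jset E v →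
      y ∈ Jset E v := by
    intro v x y z h1 h2 h3 h4
    rw [hpdef, hpdef] at h1 h2
    have := hLgood v (L.symm x) (L.symm y) (L.symm z) h1 h2 (by simpa using h3) (by simpa using h4)
    simpa using this
  have hpf : p f = n := by rw [hpdef, hf]; simp
  have hple : ∀ x, p x ≤ n := fun x => by rw [hpdef]; omega
  have hex : ∃ m, ∃ x ∈ Jset E f, p x = m := ⟨_, f, hself f, rfl⟩
  obtain ⟨m, hm⟩ : ∃ m, ∀ x, x ∈ Jset E f ↔ m ≤ p x := by
    refine ⟨Nat.find hex, fun x => ⟨fun h => Nat.find_min' hex ⟨x, h, rfl⟩, fun h => ?_⟩⟩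
    obtain ⟨y, hy, hy2⟩ := Nat.find_spec hex
    rw [← hy2] at h
    exact hconv f y x f h (by rw [hpf]; exact hple x) hy (hself f)
  have hm' : ∀ x, x ∉ Jset E f ↔ p x < m := fun x => by rw [hm]; omega
  have hfm : m ≤ p f := (hm f).1 (hself f)
  have hne : ∀ x, p x < m → f ≠ x := fun x h h' => by subst h'; omega
  have hJ1 : ∀ c x, m ≤ p c → p x < m → (E c x ↔ E f x) := by
    intro c x hc hx
    exact ⟨hout ((hm c).2 hc) (hself f) ((hm' x).2 hx), hout (hself f) ((hm c).2 hc) ((hm' x).2 hx)⟩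
  have hJ2 : ∀ c x, m ≤ p c → p x < m → (E x c ↔ ¬ E f x) := by
    intro c x hc hx
    constructor
    · intro h h'
      exact hdigon f x ⟨h', hinn ((hm c).2 hc) (hself f) ((hm' x).2 hx) h⟩
    · intro h
      by_contra h2
      have h3 : ¬ E x f := fun h4 => h2 (hinn (hself f) ((hm c).2 hc) ((hm' x).2 hx) h4)
      exact (hm' x).2 hx (hmis (hne x hx) h h3)
  have hmiss : ∀ b r, p b < m → p r < m → ¬ E f b → E f r → ¬ E r b → E b r := by
    intro b r hb hr h1 h2 h3
    by_contra h4
    have hrb : r ≠ b := fun h => by subst h; exact h1 h2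
    have : b ∈ Jset E r := hmis hrb h3 h4
    exact h1 (hinn (hself r) this (fun h => (hm' r).2 hr (hsymm h)) h2)
  have hseg := seg_ineq E ω hω p hp f m (n+1) (fun x => by have := hple x; omega)
    (by omega) hfm
    (fun j k l h1 h2 C A hC hA => block_swap E ω L hL j k l h1 h2 C A
      (fun x => by rw [hC, hpdef]) (fun x => by rw [hA, hpdef])) hmiss hJ1 hJ2
  -- good vertices
  have hG : ∀ w, w ∈ GoodSet E L ↔ ¬ E f w ∧ ∃ u, p u ≤ p w ∧ E f u ∧ E u w := by
    intro w
    unfold GoodSet Nplus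
    rw [← hf]
    constructor
    · rintro ⟨h1, i, j, h2, rfl, h3, h4⟩
      exact ⟨h1, L i, by simpa [hpdef] using h2, h3, h4⟩
    · rintro ⟨h1, u, h2, h3, h4⟩
      refine ⟨h1, L.symm u, L.symm w, ?_, by simp, by simpa using h3, by simpa using h4⟩
      rw [hpdef, hpdef] at h2
      exact h2
  have hBm : ∀ w, w ∈ B ↔ p w < m ∧ ¬ E f w ∧ ¬ ∃ u, p u ≤ p w ∧ E f u ∧ E u w := by
    intro w
    rw [hB]
    simp only [Set.mem_diff, Set.mem_setOf_eq, hG, hm', Nplus]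
    constructor
    · rintro ⟨⟨a, b⟩, c⟩
      exact ⟨c, a, fun g => b ⟨a, g⟩⟩
    · rintro ⟨a, b, c⟩
      exact ⟨⟨b, fun g => c g.2⟩, a⟩
  have hRm : ∀ w, w ∈ R ↔ p w < m ∧ (E f w ∨ ∃ u, p u ≤ p w ∧ E f u ∧ E u w) := by
    intro w
    rw [hR]
    simp only [Set.mem_diff, Set.mem_univ, true_and, Set.mem_union, hBm, hm]
    constructor
    · intro h
      push Not at h
      refine ⟨h.2, ?_⟩
      by_contra h3
      push Not at h3
      obtain ⟨u, h4, h5, h6⟩ := h.1 h.2 h3.1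
      exact h3.2 u h4 h5 h6
    · rintro ⟨h1, h2⟩ (h3 | h3)
      · exact h2.elim h3.2.1 h3.2.2
      · omega
  have heq' : (∑ x, if p x < m ∧ E f x then ω x else 0) =
      ∑ x, if p x < m ∧ ¬ E f x ∧ (∃ u, p u ≤ p x ∧ E f u ∧ E u x) then ω x else 0 := by
    rw [wt_eq, wt_eq] at heq
    refine Eq.trans (Eq.trans ?_ heq) ?_
    · refine Finset.sum_congr rfl fun x _ => ?_
      simp only [Set.mem_diff, hm', Nplus, Set.mem_setOf_eq, and_comm]
    · refine Finset.sum_congr rfl fun x _ => ?_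
      simp only [Set.mem_diff, hm', hG, and_comm, and_assoc, and_left_comm]
  -- trichotomy
  have htri : ∀ x, (x ∈ B ∧ x ∉ Jset E f ∧ x ∉ R ∧ p x < m) ∨
      (x ∉ B ∧ x ∈ Jset E f ∧ x ∉ R ∧ m ≤ p x) ∨ (x ∉ B ∧ x ∉ Jset E f ∧ x ∈ R ∧ p x < m) := by
    intro x
    rw [hBm, hRm, hm]
    by_cases h : p x < m
    · have h' : ¬ m ≤ p x := by omega
      by_cases h1 : E f x
      · exact Or.inr (Or.inr ⟨fun h => h.2.1 h1, h', ⟨h, Or.inl h1⟩, h⟩)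
      · by_cases h2 : ∃ u, p u ≤ p x ∧ E f u ∧ E u x
        · exact Or.inr (Or.inr ⟨fun h => h.2.2 h2, h', ⟨h, Or.inr h2⟩, h⟩)
        · exact Or.inl ⟨⟨h, h1, h2⟩, h', fun h => h.2.elim h1 h2, h⟩
    · have h' : m ≤ p x := by omega
      exact Or.inr (Or.inl ⟨fun g => h g.1, h', fun g => h g.1, h'⟩)
  constructor
  · intro M
    refine (hL M).trans ?_
    rw [fwdW_eq, fwdW_eq]
    have key : ∀ x y, (if L'.symm x < L'.symm y then arcW E ω x y else 0) =
        (if L.symm x < L.symm y then arcW E ω x y else 0) +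
        ((if x ∈ B ∧ y ∈ R ∧ p y < p x then arcW E ω x y else 0)
          - (if y ∈ B ∧ x ∈ R ∧ p x < p y then arcW E ω x y else 0)) +
        ((if m ≤ p x ∧ y ∈ R then arcW E ω x y else 0)
          - (if m ≤ p y ∧ x ∈ R then arcW E ω x y else 0)) := by
      intro x y
      have hsame : ((x ∈ B ∧ y ∈ B) ∨ (x ∈ Jset E f ∧ y ∈ Jset E f) ∨ (x ∈ R ∧ y ∈ R)) →
          (L'.symm x < L'.symm y ↔ p x < p y) := fun h => by rw [← hltp]; exact hin x y h
      have hne2 : p x = p y → x = y := fun h => hp h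
      simp only [hltp]
      rcases htri x with ⟨a1, a2, a3, a4⟩ | ⟨a1, a2, a3, a4⟩ | ⟨a1, a2, a3, a4⟩ <;>
      rcases htri y with ⟨b1, b2, b3, b4⟩ | ⟨b1, b2, b3, b4⟩ | ⟨b1, b2, b3, b4⟩
      · have h := hsame (by simp only [a1, a2, a3, b1, b2, b3, and_self, true_or, or_true])
        simp [h, a3, b3]
      · have h1 := hBJ x y a1 b2
        have h2 : p x < p y := by omega
        simp [h1, h2, a3, b3]
      · have h1 := hBR x y a1 b3
        have h2 : ¬ m ≤ p x := by omega
        have h4 : p x ≠ p y := fun h => by rw [hne2 h] at a1; exact b1 a1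
        by_cases h3 : p x < p y
        · have h5 : ¬ p y < p x := by omega
          simp [h1, h2, h3, h5, a1, b1, a3, b3]
        · have h5 : p y < p x := by omega
          simp [h1, h2, h3, h5, a1, b1, a3, b3]
      · have h1 := not_lt.2 (hBJ y x b1 a2).le
        have h2 : ¬ p x < p y := by omega
        simp [h1, h2, a3, b3]
      · have h := hsame (by simp only [a1, a2, a3, b1, b2, b3, and_self, true_or, or_true])
        simp [h, a3, b3]
      · have h1 := hJR x y a2 b3
        have h2 : ¬ p x < p y := by omega
        simp [h1, h2, a1, a3, b1, b3, a4]
      · have h1 := not_lt.2 (hBR y x b1 a3).le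
        have h2 : ¬ m ≤ p y := by omega
        by_cases h3 : p x < p y
        · simp [h1, h2, h3, a1, b1, a3, b3]
        · simp [h1, h2, h3, a1, b1, a3, b3]
      · have h1 := not_lt.2 (hJR y x b2 a3).le
        have h2 : p x < p y := by omega
        simp [h1, h2, a1, a3, b1, b3, b4]
      · have h := hsame (by simp only [a1, a2, a3, b1, b2, b3, and_self, true_or, or_true])
        have h2 : ¬ m ≤ p y := by omega
        have h3 : ¬ m ≤ p x := by omega
        simp [h, a1, b1, h2, h3]
    have keysum : (∑ x, ∑ y, if L'.symm x < L'.symm y then arcW E ω x y else 0) =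
        (∑ x, ∑ y, if L.symm x < L.symm y then arcW E ω x y else 0) +
        (∑ x, ∑ y, if x ∈ B ∧ y ∈ R ∧ p y < p x then arcW E ω x y - arcW E ω y x else 0) +
        (∑ x, ∑ y, if m ≤ p x ∧ y ∈ R then arcW E ω x y - arcW E ω y x else 0) := by
      simp only [key, Finset.sum_add_distrib, Finset.sum_sub_distrib]
      rw [Finset.sum_comm (f := fun x y => if y ∈ B ∧ x ∈ R ∧ p x < p y then arcW E ω x y else 0),
        Finset.sum_comm (f := fun x y => if m ≤ p y ∧ x ∈ R then arcW E ω x y else 0)]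
      simp only [← Finset.sum_sub_distrib]
      congr 1
      · congr 1
        refine Finset.sum_congr rfl fun x _ => Finset.sum_congr rfl fun y _ => ?_
        split_ifs <;> simp
      · refine Finset.sum_congr rfl fun x _ => Finset.sum_congr rfl fun y _ => ?_
        split_ifs <;> simp
    rw [keysum]
    have hz2 : (∑ x, ∑ y, if m ≤ p x ∧ y ∈ R then arcW E ω x y - arcW E ω y x else 0) = 0 := by
      apply Finset.sum_eq_zero
      intro c _
      by_cases hc : m ≤ p c
      · have : ∀ y, (if m ≤ p c ∧ y ∈ R then arcW E ω c y - arcW E ω y c else 0) =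
            ω c * (if p y < m ∧ E f y then ω y else 0) - ω c *
            (if p y < m ∧ ¬ E f y ∧ (∃ u, p u ≤ p y ∧ E f u ∧ E u y) then ω y else 0) := by
          intro y
          by_cases hy : p y < m
          · by_cases hfy : E f y
            · simp [hc, hRm, hy, hfy, arcW, hJ1 c y hc hy, hJ2 c y hc hy]
            · simp only [hc, hRm, hy, hfy, arcW, hJ1 c y hc hy, hJ2 c y hc hy, true_and,
                false_or, not_false_eq_true, if_true, if_false]
              split_ifs <;> ring
          · simp [hy, hRm]
        simp only [this, Finset.sum_sub_distrib, ← Finset.mul_sum, heq']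
        simp
      · simp [hc]
    have hz1 : 0 ≤ ∑ x, ∑ y,
        if x ∈ B ∧ y ∈ R ∧ p y < p x then arcW E ω x y - arcW E ω y x else 0 := by
      apply Finset.sum_nonneg
      intro b _
      by_cases hb : b ∈ B
      · obtain ⟨hb1, hb2, hb3⟩ := (hBm b).1 hb
        have h1 := hseg m (p b + 1) (by omega)
        have h2 : ω b * ((∑ x, if p x < p b ∧ E f x then ω x else 0) -
            ∑ x, if p x < p b ∧ ¬ E f x ∧ (∃ u, p u ≤ p x ∧ E f u ∧ E u x) then ω x else 0) ≤
            ∑ y, if b ∈ B ∧ y ∈ R ∧ p y < p b then arcW E ω b y - arcW E ω y b else 0 := by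
          rw [← Finset.sum_sub_distrib, Finset.mul_sum]
          apply Finset.sum_le_sum
          intro y _
          by_cases hy : p y < p b
          · have hym : p y < m := by omega
            have := mul_pos (hω b) (hω y)
            by_cases hfy : E f y
            · have h3 : ¬ E y b := fun h => hb3 ⟨y, hy.le, hfy, h⟩
              have h4 := hmiss b y hb1 hym hb2 hfy h3
              simp [hb, hRm, hy, hym, hfy, arcW, h3, h4]
            · by_cases hgy : ∃ u, p u ≤ p y ∧ E f u ∧ E u y
              · have hyR : y ∈ R := (hRm y).2 ⟨hym, Or.inr hgy⟩
                rw [if_neg (fun h => hfy h.2), if_pos ⟨hy, hfy, hgy⟩, if_pos ⟨hb, hyR, hy⟩]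
                unfold arcW
                split_ifs <;> linarith
              · have hyR : y ∉ R := fun h => ((hRm y).1 h).2.elim hfy hgy
                rw [if_neg (fun h => hfy h.2), if_neg (fun h => hgy h.2.2), if_neg (fun h => hyR h.2.1)]
                simp
          · simp [hy]
        refine le_trans (mul_nonneg (hω b).le ?_) h2
        have h5 : (∑ x, if p x < m ∧ E f x then ω x else 0) =
            (∑ x, if p x < p b ∧ E f x then ω x else 0) +
            ∑ x, if p b + 1 ≤ p x ∧ p x < m ∧ E f x then ω x else 0 := by
          rw [← Finset.sum_add_distrib]
          refine Finset.sum_congr rfl fun x _ => ?_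
          by_cases hfx : E f x
          · have : p x ≠ p b := fun h => by rw [hp h] at hfx; exact hb2 hfx
            simp only [hfx, and_true]
            split_ifs <;> first | omega | simp
          · simp [hfx]
        have h6 : (∑ x, if p x < p b ∧ ¬ E f x ∧ (∃ u, p u ≤ p x ∧ E f u ∧ E u x)
              then ω x else 0) +
            (∑ x, if p b + 1 ≤ p x ∧ p x < m ∧ ¬ E f x ∧
              ∃ u, p b + 1 ≤ p u ∧ p u ≤ p x ∧ E f u ∧ E u x then ω x else 0) ≤
            ∑ x, if p x < m ∧ ¬ E f x ∧ (∃ u, p u ≤ p x ∧ E f u ∧ E u x) then ω x else 0 := by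
          rw [← Finset.sum_add_distrib]
          apply Finset.sum_le_sum
          intro x _
          have := hω x
          by_cases c1 : p x < p b ∧ ¬ E f x ∧ (∃ u, p u ≤ p x ∧ E f u ∧ E u x)
          · rw [if_pos c1, if_neg (by omega), if_pos ⟨by omega, c1.2⟩]
            simp
          · rw [if_neg c1]
            by_cases c2 : p b + 1 ≤ p x ∧ p x < m ∧ ¬ E f x ∧
                ∃ u, p b + 1 ≤ p u ∧ p u ≤ p x ∧ E f u ∧ E u x
            · obtain ⟨a1, a2, a3, u, a4, a5, a6, a7⟩ := id c2
              rw [if_pos c2, if_pos ⟨a2, a3, u, a5, a6, a7⟩]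
              simp
            · rw [if_neg c2]
              split_ifs <;> simp <;> linarith
        linarith
      · simp [hb]
    linarith
  · -- consecutiveness
    intro v
    have hdich : (∀ x ∈ Jset E v, x ∈ B) ∨ (∀ x ∈ Jset E v, x ∈ Jset E f) ∨
        (∀ x ∈ Jset E v, x ∈ R) := by
      by_cases hvf : v ∈ Jset E f
      · exact Or.inr (Or.inl fun x hx => htrans hvf hx)
      have hfv : f ∉ Jset E v := fun h => hvf (hsymm h)
      have hdis : ∀ x ∈ Jset E v, p x < m := fun x hx =>
        (hm' x).1 fun h => hvf (htrans h (hsymm hx))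
      by_cases hg : ∃ x ∈ Jset E v, x ∈ R
      · right; right
        obtain ⟨w, hw, hwR⟩ := hg
        intro x hx
        rw [hRm] at hwR ⊢
        refine ⟨hdis x hx, ?_⟩
        by_cases hfw : E f w
        · exact Or.inl (hinn hw hx hfv hfw)
        · right
          obtain ⟨u, hu1, hu2, hu3⟩ := hwR.2.resolve_left hfw
          have huK : u ∉ Jset E v := fun h => hfw (hinn h hw hfv hu2)
          refine ⟨u, ?_, hu2, hinn hw hx huK hu3⟩
          by_contra hlt
          push Not at hlt
          exact huK (hconv v x u w hlt.le hu1 hx hw)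
      · left
        intro x hx
        rcases htri x with h | h | h
        · exact h.1
        · have := hdis x hx
          omega
        · exact absurd ⟨x, hx, h.2.2.1⟩ hg
    intro i j k hij hjk hi hk
    obtain ⟨x, rfl⟩ := L'.symm.surjective i
    obtain ⟨y, rfl⟩ := L'.symm.surjective j
    obtain ⟨z, rfl⟩ := L'.symm.surjective k
    simp only [Equiv.apply_symm_apply] at hi hk ⊢
    have fin : (y ∈ B ∧ x ∈ B ∧ z ∈ B) ∨ (y ∈ Jset E f ∧ x ∈ Jset E f ∧ z ∈ Jset E f) ∨
        (y ∈ R ∧ x ∈ R ∧ z ∈ R) → y ∈ Jset E v := by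
      intro h
      have e1 := hin y x (h.imp (fun h => ⟨h.1, h.2.1⟩) (Or.imp (fun h => ⟨h.1, h.2.1⟩) (fun h => ⟨h.1, h.2.1⟩)))
      have e2 := hin z y (h.imp (fun h => ⟨h.2.2, h.1⟩) (Or.imp (fun h => ⟨h.2.2, h.1⟩) (fun h => ⟨h.2.2, h.1⟩)))
      rw [hltp] at e1 e2
      apply hconv v x y z _ _ hi hk
      · by_contra h'
        push Not at h'
        exact absurd (e1.2 h') (not_lt.2 hij)
      · by_contra h'
        push Not at h'
        exact absurd (e2.2 h') (not_lt.2 hjk)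
    apply fin
    rcases hdich with h | h | h
    · have hx := h x hi
      have hz := h z hk
      rcases htri y with hy | hy | hy
      · exact Or.inl ⟨hy.1, hx, hz⟩
      · exact absurd (hBJ z y hz hy.2.1) (not_lt.2 hjk)
      · exact absurd (hBR z y hz hy.2.2.1) (not_lt.2 hjk)
    · have hx := h x hi
      have hz := h z hk
      rcases htri y with hy | hy | hy
      · exact absurd (hBJ y x hy.1 hx) (not_lt.2 hij)
      · exact Or.inr (Or.inl ⟨hy.2.1, hx, hz⟩)
      · exact absurd (hJR z y hz hy.2.2.1) (not_lt.2 hjk)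
    · have hx := h x hi
      have hz := h z hk
      rcases htri y with hy | hy | hy
      · exact absurd (hBR y x hy.1 hx) (not_lt.2 hij)
      · exact absurd (hJR y x hy.2.1 hx) (not_lt.2 hij)
      · exact Or.inr (Or.inr ⟨hy.2.2.1, hx, hz⟩)
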